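/- Let f(z₀, z) = P(z₀, z)/q(z₀, z) be a rational ℂ^{m×m}-valued function of d+1 complex variables belonging to the Pick class 𝒫_{d+1}^{m×m}, where P and q are coprime polynomials, and suppose deg_{z₀} f = n₀ ≤ n for a natural number n. Then the function f̂(ζ₁,…,ζ_n, z) = 𝐃_{z₀}^n[f] obtained by applying the degree reduction operator in z₀ (replacing z₀^k by binom(n,k)⁻¹ σ_k(ζ₁,…,ζ_n) separately in the numerator and the denominator) belongs to the Pick class 𝒫_{d+n}^{m×m}, is affine of degree at most one and symmetric in the variables ζ₁,…,ζ_n, and satisfies f̂(z₀, …, z₀, z) = f(z₀, z). -/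

import Mathlib

open Matrix MvPolynomial
open scoped ComplexOrder

noncomputable section

/-- The open upper poly-half-plane (coordinates indexed by `ι`). -/
def UHP (ι : Type*) : Set (ι → ℂ) := {z | ∀ k, 0 < (z k).im}

/-- `(M - Mᴴ)/(2i)`. -/
def imPart {n : Type*} (M : Matrix n n ℂ) : Matrix n n ℂ :=
  (2 * Complex.I)⁻¹ • (M - Mᴴ)

/-- The degree reduction operator `𝐃_{z₀}^n` in the variable `z₀` (the variable `0` of
`Fin (d+1)`): it sends `Σ_k p_k(z) z₀^k` to
`Σ_k binom(n,k)⁻¹ p_k(z) σ_k(ζ₁,…,ζ_n)`, a polynomial in the variables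
`Fin n ⊕ Fin d` (the `ζ`'s followed by the old `z`'s). -/
def degRed (d n : ℕ) (p : MvPolynomial (Fin (d + 1)) ℂ) : MvPolynomial (Fin n ⊕ Fin d) ℂ :=
  ∑ k ∈ Finset.range (n + 1),
    (((n.choose k : ℂ)⁻¹) • rename Sum.inr ((finSuccEquiv ℂ d p).coeff k)) *
      rename Sum.inl (esymm (Fin n) ℂ k)

/-- The symmetric multi-affine form of a univariate polynomial, evaluated at a multiset whose
cardinality plays the role of the formal degree of the polynomial. -/
def polarization (h : Polynomial ℂ) (s : Multiset ℂ) : ℂ :=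
  ∑ k ∈ Finset.range (s.card + 1), h.coeff k * (s.card.choose k : ℂ)⁻¹ * s.esymm k

/-- The polar derivative with pole `a` of a polynomial of formal degree `n`. -/
def polarDerivative (n : ℕ) (a : ℂ) (h : Polynomial ℂ) : Polynomial ℂ :=
  h + Polynomial.C (n : ℂ)⁻¹ * ((Polynomial.C a - Polynomial.X) * Polynomial.derivative h)

theorem Multiset.esymm_cons_succ (a : ℂ) (s : Multiset ℂ) (k : ℕ) :
    (a ::ₘ s).esymm (k + 1) = s.esymm (k + 1) + a * s.esymm k := by
  simp [Multiset.esymm, Multiset.powersetCard_cons, Multiset.map_map,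
    Multiset.sum_map_mul_left]

theorem Multiset.esymm_zero_right (s : Multiset ℂ) : s.esymm 0 = 1 := by
  simp [Multiset.esymm]

theorem Multiset.esymm_card_succ (s : Multiset ℂ) : s.esymm (s.card + 1) = 0 := by
  simp [Multiset.esymm, Multiset.powersetCard_eq_empty]

theorem coeff_polarDerivative (n : ℕ) (a : ℂ) (h : Polynomial ℂ) (k : ℕ) :
    (polarDerivative n a h).coeff k =
      h.coeff k + (n : ℂ)⁻¹ * (a * (h.coeff (k + 1) * (k + 1)) - k * h.coeff k) := by
  rw [polarDerivative, Polynomial.coeff_add, Polynomial.coeff_C_mul, sub_mul, Polynomial.coeff_sub,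
    Polynomial.coeff_C_mul, Polynomial.coeff_derivative]
  cases k with
  | zero => simp
  | succ k => rw [Polynomial.coeff_X_mul, Polynomial.coeff_derivative]; push_cast; ring

theorem natDegree_polarDerivative_le {n : ℕ} (a : ℂ) {h : Polynomial ℂ}
    (hn : h.natDegree ≤ n + 1) : (polarDerivative (n + 1) a h).natDegree ≤ n := by
  rw [Polynomial.natDegree_le_iff_coeff_eq_zero]
  intro k hk
  rw [coeff_polarDerivative, Polynomial.coeff_eq_zero_of_natDegree_lt (n := k + 1) (by omega)]
  rcases eq_or_ne k (n + 1) with rfl | hne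
  · have : ((n : ℂ) + 1) ≠ 0 := by exact_mod_cast n.succ_ne_zero
    push_cast
    field_simp
    ring
  · rw [Polynomial.coeff_eq_zero_of_natDegree_lt (n := k) (by omega)]
    simp

theorem polarization_cons (h : Polynomial ℂ) (a : ℂ) (s : Multiset ℂ) :
    polarization h (a ::ₘ s) = polarization (polarDerivative (s.card + 1) a h) s := by
  set n := s.card with hn
  have key : ∀ k ∈ Finset.range (n + 1),
      (polarDerivative (n + 1) a h).coeff k * (n.choose k : ℂ)⁻¹ * s.esymm k =
        h.coeff k * ((n + 1).choose k : ℂ)⁻¹ * s.esymm k +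
        h.coeff (k + 1) * ((n + 1).choose (k + 1) : ℂ)⁻¹ * (a * s.esymm k) := by
    intro k hk
    have hk' : k ≤ n := Nat.lt_succ_iff.mp (Finset.mem_range.mp hk)
    have h0 : ((n : ℂ) + 1) ≠ 0 := by exact_mod_cast n.succ_ne_zero
    have h1 : (n.choose k : ℂ) ≠ 0 := by exact_mod_cast (Nat.choose_pos hk').ne'
    have h2 : ((n + 1).choose k : ℂ) ≠ 0 := by
      exact_mod_cast (Nat.choose_pos (hk'.trans n.le_succ)).ne'
    have h3 : ((n + 1).choose (k + 1) : ℂ) ≠ 0 := by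
      exact_mod_cast (Nat.choose_pos (Nat.succ_le_succ hk')).ne'
    have e1 : ((n : ℂ) + 1) * n.choose k = (n + 1).choose (k + 1) * (k + 1) := by
      exact_mod_cast Nat.add_one_mul_choose_eq n k
    have e2 : (n.choose k : ℂ) * (n + 1) = (n + 1).choose k * (n + 1 - k) := by
      have := Nat.choose_mul_succ_eq n k
      rw [← Nat.cast_inj (R := ℂ)] at this
      push_cast [Nat.cast_sub (hk'.trans n.le_succ)] at this
      exact this
    have i1 : ((n + 1).choose (k + 1) : ℂ)⁻¹ = (k + 1) * ((n : ℂ) + 1)⁻¹ * (n.choose k : ℂ)⁻¹ := by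
      field_simp
      linear_combination e1
    have i2 : ((n + 1).choose k : ℂ)⁻¹ =
        (n + 1 - k) * ((n : ℂ) + 1)⁻¹ * (n.choose k : ℂ)⁻¹ := by
      field_simp
      linear_combination e2
    have i3 : ((n : ℂ) + 1 - k) * ((n : ℂ) + 1)⁻¹ = 1 - k * ((n : ℂ) + 1)⁻¹ := by
      field_simp
    rw [coeff_polarDerivative, i1, i2, i3]
    push_cast
    ring
  rw [polarization, polarization, ← hn, Finset.sum_congr rfl key, Finset.sum_add_distrib,
    Multiset.card_cons, ← hn, Finset.sum_range_succ']
  simp only [Multiset.esymm_cons_succ, mul_add, Finset.sum_add_distrib, Multiset.esymm_zero_right,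
    Nat.choose_zero_right]
  rw [Finset.sum_range_succ _ n, Finset.sum_range_succ' (fun k => h.coeff k * _ * _) n,
    Multiset.esymm_zero_right, Nat.choose_zero_right, hn, Multiset.esymm_card_succ]
  ring

theorem norm_conj_sub_le_iff {z r : ℂ} (hz : 0 < z.im) :
    ‖starRingEnd ℂ z - r‖ ≤ ‖z - r‖ ↔ r.im ≤ 0 := by
  rw [← sq_le_sq₀ (norm_nonneg _) (norm_nonneg _), Complex.sq_norm, Complex.sq_norm,
    Complex.normSq_apply, Complex.normSq_apply]
  simp only [Complex.sub_re, Complex.sub_im, Complex.conj_re, Complex.conj_im]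
  constructor
  · intro h
    by_contra! hr
    nlinarith [mul_pos hz hr]
  · intro h
    nlinarith [mul_nonneg hz.le (neg_nonneg.mpr h)]

/-- Laguerre's theorem for the upper half-plane. -/
theorem eval_polarDerivative_ne_zero {n : ℕ} {a z : ℂ} {h : Polynomial ℂ}
    (hn : h.natDegree ≤ n + 1) (hh : ∀ w : ℂ, 0 < w.im → h.eval w ≠ 0)
    (ha : 0 < a.im) (hz : 0 < z.im) : (polarDerivative (n + 1) a h).eval z ≠ 0 := by
  have hz0 := hh z hz
  have h00 : h ≠ 0 := by rintro rfl; simp at hz0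
  have hspl := IsAlgClosed.splits h
  intro h0
  set W := (h.roots.map fun r => 1 / (z - r)).sum with hW
  have hWeq : (z - a) * W = n + 1 := by
    have h1 := hspl.eval_derivative_eq_eval_mul_sum hz0
    rw [← hW] at h1
    simp only [polarDerivative, Polynomial.eval_add, Polynomial.eval_mul, Polynomial.eval_C,
      Polynomial.eval_sub, Polynomial.eval_X, h1] at h0
    push_cast at h0
    have h2 := (mul_eq_zero.mp (show h.eval z * (n + 1 + (a - z) * W) = 0 by
      field_simp at h0
      linear_combination h0)).resolve_left hz0
    linear_combination -h2
  have hsum : ∀ s : Multiset ℂ, (∀ r ∈ s, r.im ≤ 0) →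
      ‖2 * z.im * (s.map fun r => 1 / (z - r)).sum + s.card * Complex.I‖ ≤ s.card := by
    intro s
    induction s using Multiset.induction_on with
    | empty => simp
    | cons r s ih =>
      intro hs
      have hr := hs r (Multiset.mem_cons_self r s)
      have hzr : z - r ≠ 0 := fun h => by
        have := congrArg Complex.im h
        simp only [Complex.sub_im, Complex.zero_im] at this
        linarith
      have hw : ‖2 * z.im * (1 / (z - r)) + Complex.I‖ ≤ 1 := by
        have e : 2 * z.im * (1 / (z - r)) + Complex.I =
            Complex.I * (starRingEnd ℂ z - r) / (z - r) := by
          rw [eq_div_iff hzr, add_mul, mul_assoc, one_div, inv_mul_cancel₀ hzr]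
          apply Complex.ext <;> simp
          ring
        rw [e, norm_div, norm_mul, Complex.norm_I, one_mul, div_le_one (norm_pos_iff.mpr hzr)]
        exact (norm_conj_sub_le_iff hz).mpr hr
      rw [Multiset.map_cons, Multiset.sum_cons, Multiset.card_cons]
      calc _ = ‖(2 * z.im * (1 / (z - r)) + Complex.I) +
            (2 * z.im * (s.map fun r => 1 / (z - r)).sum + s.card * Complex.I)‖ := by
            push_cast; ring_nf
        _ ≤ 1 + s.card :=
            norm_add_le_of_le hw (ih fun x hx => hs x (Multiset.mem_cons_of_mem hx))
        _ = _ := by push_cast; ring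
  have hroots : ∀ r ∈ h.roots, r.im ≤ 0 := fun r hr =>
    not_lt.mp fun hr' => hh r hr' ((Polynomial.mem_roots h00).mp hr)
  have hcard : (h.roots.card : ℝ) ≤ n + 1 := by
    exact_mod_cast (Polynomial.card_roots' h).trans hn
  have hbound : ‖2 * z.im * W + (n + 1) * Complex.I‖ ≤ n + 1 := by
    calc _ = ‖(2 * z.im * W + h.roots.card * Complex.I) +
          ((n + 1 - h.roots.card : ℝ) : ℂ) * Complex.I‖ := by push_cast; ring_nf
      _ ≤ h.roots.card + (n + 1 - h.roots.card) := by
          refine norm_add_le_of_le (hsum _ hroots) ?_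
          rw [norm_mul, Complex.norm_I, mul_one, Complex.norm_real, Real.norm_eq_abs,
            abs_of_nonneg (by linarith)]
      _ = _ := by ring
  have hconj : (z - a) * (2 * z.im * W + (n + 1) * Complex.I) =
      ((n + 1 : ℝ) : ℂ) * (Complex.I * (starRingEnd ℂ z - a)) := by
    have e : (z - a) * (2 * z.im * W + (n + 1) * Complex.I) =
        2 * z.im * (n + 1) + (n + 1) * Complex.I * (z - a) := by
      linear_combination (2 * z.im : ℂ) * hWeq
    rw [e]
    apply Complex.ext <;> simp
    ring
  have hpos : (0 : ℝ) < n + 1 := by positivity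
  have hle : ‖starRingEnd ℂ z - a‖ ≤ ‖z - a‖ := by
    have := congrArg norm hconj
    rw [norm_mul, norm_mul, norm_mul, Complex.norm_I, one_mul, Complex.norm_real,
      Real.norm_of_nonneg hpos.le] at this
    have h3 := mul_le_mul_of_nonneg_left hbound (norm_nonneg (z - a))
    rw [this, mul_comm] at h3
    exact le_of_mul_le_mul_right h3 hpos
  exact ha.not_ge ((norm_conj_sub_le_iff hz).mp hle)

/-- The Grace–Walsh–Szegő theorem for the upper half-plane. -/
theorem polarization_ne_zero (s : Multiset ℂ) (hs : ∀ a ∈ s, 0 < a.im) {h : Polynomial ℂ}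
    (hdeg : h.natDegree ≤ s.card) (hh : ∀ w : ℂ, 0 < w.im → h.eval w ≠ 0) :
    polarization h s ≠ 0 := by
  induction s using Multiset.induction_on generalizing h with
  | empty =>
    have := hh Complex.I (by simp)
    rw [Polynomial.eq_C_of_natDegree_le_zero hdeg, Polynomial.eval_C] at this
    simpa [polarization, Multiset.esymm] using this
  | cons a s ih =>
    rw [polarization_cons]
    rw [Multiset.card_cons] at hdeg
    exact ih (fun x hx => hs x (Multiset.mem_cons_of_mem hx))
      (natDegree_polarDerivative_le a hdeg)
      fun w hw => eval_polarDerivative_ne_zero hdeg hh (hs a (Multiset.mem_cons_self a s)) hw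

theorem polarization_replicate {h : Polynomial ℂ} {n : ℕ} (hdeg : h.natDegree ≤ n) (a : ℂ) :
    polarization h (Multiset.replicate n a) = h.eval a := by
  rw [Polynomial.eval_eq_sum_range' (Nat.lt_succ_of_le hdeg), polarization,
    Multiset.card_replicate]
  refine Finset.sum_congr rfl fun k hk => ?_
  have hk' : (n.choose k : ℂ) ≠ 0 := by
    exact_mod_cast (Nat.choose_pos (Nat.lt_succ_iff.mp (Finset.mem_range.mp hk))).ne'
  have : (Multiset.replicate n a).esymm k = n.choose k * a ^ k := by
    have e : (Multiset.replicate n a).powersetCard k =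
        Multiset.replicate (n.choose k) (Multiset.replicate k a) := by
      rw [Multiset.eq_replicate]
      refine ⟨by simp, fun t ht => ?_⟩
      rw [Multiset.mem_powersetCard] at ht
      rw [Multiset.eq_replicate]
      exact ⟨ht.2, fun b hb => Multiset.eq_of_mem_replicate (Multiset.mem_of_le ht.1 hb)⟩
    rw [Multiset.esymm, e]
    simp
  rw [this]
  field_simp

theorem eval_degRed (d n : ℕ) (p : MvPolynomial (Fin (d + 1)) ℂ) (w : Fin n ⊕ Fin d → ℂ) :
    eval w (degRed d n p) =
      polarization ((finSuccEquiv ℂ d p).map (eval fun i => w (Sum.inr i)))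
        (Finset.univ.val.map fun l => w (Sum.inl l)) := by
  simp only [degRed, polarization, map_sum, map_mul, smul_eval, eval_rename, Multiset.card_map,
    Finset.card_val, Finset.card_univ, Fintype.card_fin, Polynomial.coeff_map]
  refine Finset.sum_congr rfl fun k _ => ?_
  have : eval (w ∘ Sum.inl) (esymm (Fin n) ℂ k) =
      (Finset.univ.val.map fun l => w (Sum.inl l)).esymm k := by
    rw [← coe_aeval_eq_eval]
    exact aeval_esymm_eq_multiset_esymm (Fin n) ℂ k (w ∘ Sum.inl)
  rw [this]
  simp only [Function.comp_def]
  ring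

/-- The degree reduction operator as a linear map. -/
def degRedLinearMap (d n : ℕ) :
    MvPolynomial (Fin (d + 1)) ℂ →ₗ[ℂ] MvPolynomial (Fin n ⊕ Fin d) ℂ where
  toFun := degRed d n
  map_add' p q := by
    simp only [degRed, map_add, Polynomial.coeff_add, smul_add, add_mul, Finset.sum_add_distrib]
  map_smul' c p := by
    simp only [degRed, map_smul, Polynomial.coeff_smul, Finset.smul_sum, RingHom.id_apply,
      smul_mul_assoc]
    exact Finset.sum_congr rfl fun k _ => smul_comm _ _ _

theorem degRedLinearMap_apply (d n : ℕ) (p : MvPolynomial (Fin (d + 1)) ℂ) :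
    degRedLinearMap d n p = degRed d n p := rfl

theorem eval_degRed_diagonal {d n : ℕ} {p : MvPolynomial (Fin (d + 1)) ℂ}
    (hp : (finSuccEquiv ℂ d p).natDegree ≤ n) (a : ℂ) (z : Fin d → ℂ) :
    eval (Sum.elim (fun _ => a) z) (degRed d n p) = eval (Fin.cons a z : Fin (d + 1) → ℂ) p := by
  rw [eval_degRed, eval_eq_eval_mv_eval',
    ← polarization_replicate (Polynomial.natDegree_map_le.trans hp)]
  simp [Multiset.map_const']

theorem eval_degRed_ne_zero {d n : ℕ} {p : MvPolynomial (Fin (d + 1)) ℂ}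
    (hp : (finSuccEquiv ℂ d p).natDegree ≤ n) (h : ∀ z ∈ UHP (Fin (d + 1)), eval z p ≠ 0)
    {w : Fin n ⊕ Fin d → ℂ} (hw : w ∈ UHP (Fin n ⊕ Fin d)) : eval w (degRed d n p) ≠ 0 := by
  rw [eval_degRed]
  refine polarization_ne_zero _ ?_ (by simpa using Polynomial.natDegree_map_le.trans hp) ?_
  · simp only [Multiset.mem_map]
    rintro _ ⟨l, _, rfl⟩
    exact hw _
  · intro a ha
    rw [← eval_eq_eval_mv_eval']
    exact h _ (Fin.cases ha fun i => hw (Sum.inr i))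

theorem im_eval_degRed_div_nonneg {d n : ℕ} {p q : MvPolynomial (Fin (d + 1)) ℂ}
    (hp : (finSuccEquiv ℂ d p).natDegree ≤ n) (hq : (finSuccEquiv ℂ d q).natDegree ≤ n)
    (hq0 : ∀ z ∈ UHP (Fin (d + 1)), eval z q ≠ 0)
    (him : ∀ z ∈ UHP (Fin (d + 1)), 0 ≤ ((eval z q)⁻¹ * eval z p).im)
    {w : Fin n ⊕ Fin d → ℂ} (hw : w ∈ UHP (Fin n ⊕ Fin d)) :
    0 ≤ ((eval w (degRed d n q))⁻¹ * eval w (degRed d n p)).im := by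
  by_contra! hneg
  set c := (eval w (degRed d n q))⁻¹ * eval w (degRed d n p) with hc
  have hqw := eval_degRed_ne_zero hq hq0 hw
  refine eval_degRed_ne_zero (p := p - c • q) ?_ (fun z hz h0 => ?_) hw ?_
  · rw [map_sub, map_smul]
    exact (Polynomial.natDegree_sub_le _ _).trans
      (max_le hp ((Polynomial.natDegree_smul_le _ _).trans hq))
  · rw [map_sub, smul_eval, sub_eq_zero] at h0
    have := him z hz
    rw [h0, mul_comm c, inv_mul_cancel_left₀ (hq0 z hz)] at this
    exact hneg.not_ge this
  · rw [← degRedLinearMap_apply, map_sub, map_smul, degRedLinearMap_apply, degRedLinearMap_apply,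
      map_sub, smul_eval, hc, mul_comm, mul_inv_cancel_left₀ hqw, sub_self]

theorem star_dotProduct_imPart_mulVec {m : ℕ} (M : Matrix (Fin m) (Fin m) ℂ) (v : Fin m → ℂ) :
    star v ⬝ᵥ imPart M *ᵥ v = ((star v ⬝ᵥ M *ᵥ v).im : ℂ) := by
  have h : star v ⬝ᵥ Mᴴ *ᵥ v = starRingEnd ℂ (star v ⬝ᵥ M *ᵥ v) := by
    rw [starRingEnd_apply, star_dotProduct, star_mulVec, conjTranspose_conjTranspose,
      dotProduct_mulVec]
  rw [imPart, smul_mulVec, dotProduct_smul, sub_mulVec, dotProduct_sub, h, Complex.sub_conj,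
    smul_eq_mul]
  field_simp [Complex.I_ne_zero]
  push_cast
  ring

theorem posSemidef_imPart_iff {m : ℕ} (M : Matrix (Fin m) (Fin m) ℂ) :
    (imPart M).PosSemidef ↔ ∀ v, 0 ≤ (star v ⬝ᵥ M *ᵥ v).im := by
  rw [posSemidef_iff_dotProduct_mulVec]
  simp only [star_dotProduct_imPart_mulVec, Complex.zero_le_real]
  refine and_iff_right ?_
  rw [IsHermitian, imPart, conjTranspose_smul, conjTranspose_sub, conjTranspose_conjTranspose]
  simp only [star_inv₀, star_mul', Complex.star_def, Complex.conj_I, map_ofNat, mul_neg, inv_neg,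
    neg_smul, ← smul_neg, neg_sub]

theorem star_dotProduct_smul_of_eval_mulVec {ι : Type*} {m : ℕ} (a : ℂ) (z : ι → ℂ)
    (P : Matrix (Fin m) (Fin m) (MvPolynomial ι ℂ)) (v : Fin m → ℂ) :
    star v ⬝ᵥ (a • Matrix.of fun i j => eval z (P i j)) *ᵥ v =
      a * eval z (∑ i, ∑ j, (star (v i) * v j) • P i j) := by
  rw [smul_mulVec, dotProduct_smul, smul_eq_mul]
  simp only [dotProduct, mulVec, of_apply, map_sum,
    smul_eval, Finset.mul_sum, Pi.star_apply]
  refine Finset.sum_congr rfl fun i _ => Finset.sum_congr rfl fun j _ => ?_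
  ring

theorem posSemidef_imPart_degRed {d m n : ℕ}
    {P : Matrix (Fin m) (Fin m) (MvPolynomial (Fin (d + 1)) ℂ)}
    {q : MvPolynomial (Fin (d + 1)) ℂ}
    (hdegP : ∀ i j, (finSuccEquiv ℂ d (P i j)).natDegree ≤ n)
    (hdegq : (finSuccEquiv ℂ d q).natDegree ≤ n)
    (hq0 : ∀ z ∈ UHP (Fin (d + 1)), eval z q ≠ 0)
    (hpick : ∀ z ∈ UHP (Fin (d + 1)),
      (imPart ((eval z q)⁻¹ • Matrix.of fun i j => eval z (P i j))).PosSemidef)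
    {w : Fin n ⊕ Fin d → ℂ} (hw : w ∈ UHP (Fin n ⊕ Fin d)) :
    (imPart ((eval w (degRed d n q))⁻¹ •
      Matrix.of fun i j => eval w (degRed d n (P i j)))).PosSemidef := by
  rw [posSemidef_imPart_iff]
  intro v
  have e : ∑ i, ∑ j, (star (v i) * v j) • degRed d n (P i j) =
      degRed d n (∑ i, ∑ j, (star (v i) * v j) • P i j) := by
    simp only [← degRedLinearMap_apply, map_sum, map_smul]
  rw [star_dotProduct_smul_of_eval_mulVec _ _ (fun i j => degRed d n (P i j)), e]
  refine im_eval_degRed_div_nonneg ?_ hdegq hq0 (fun z hz => ?_) hw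
  · simp only [map_sum, map_smul]
    exact Polynomial.natDegree_sum_le_of_forall_le _ _ fun i _ =>
      Polynomial.natDegree_sum_le_of_forall_le _ _ fun j _ =>
        (Polynomial.natDegree_smul_le _ _).trans (hdegP i j)
  · rw [← star_dotProduct_smul_of_eval_mulVec]
    exact (posSemidef_imPart_iff _).mp (hpick z hz) v

theorem degreeOf_inl_degRed_le (d n : ℕ) (p : MvPolynomial (Fin (d + 1)) ℂ) (l : Fin n) :
    degreeOf (Sum.inl l) (degRed d n p) ≤ 1 := by
  refine (degreeOf_sum_le _ _ _).trans (Finset.sup_le fun k _ => ?_)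
  refine (degreeOf_mul_le _ _ _).trans ?_
  have h1 : degreeOf (Sum.inl l) (((n.choose k : ℂ)⁻¹) •
      rename (Sum.inr : Fin d → Fin n ⊕ Fin d) ((finSuccEquiv ℂ d p).coeff k)) = 0 := by
    rw [← map_smul]
    by_contra h
    obtain ⟨x, _, hx⟩ := mem_vars_rename _ _ (mem_vars_iff_degreeOf_ne_zero.mpr h)
    exact Sum.inr_ne_inl hx
  rw [h1, zero_add, degreeOf_rename_of_injective Sum.inl_injective, esymm]
  refine (degreeOf_sum_le _ _ _).trans (Finset.sup_le fun t _ => ?_)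
  refine (degreeOf_prod_le _ _ _).trans ?_
  simp only [degreeOf_X, Finset.sum_ite_eq]
  split_ifs <;> simp

theorem rename_sumMap_degRed (d n : ℕ) (p : MvPolynomial (Fin (d + 1)) ℂ)
    (σ : Equiv.Perm (Fin n)) : rename (Sum.map σ id) (degRed d n p) = degRed d n p := by
  simp only [degRed, map_sum, map_mul, map_smul, rename_rename]
  refine Finset.sum_congr rfl fun k _ => ?_
  conv_rhs => rw [← esymm_isSymmetric (Fin n) ℂ k σ, rename_rename]
  rfl

theorem UHP_eq_pi (ι : Type*) : UHP ι = Set.pi Set.univ fun _ => {c : ℂ | 0 < c.im} := by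
  ext z
  simp [UHP]

theorem isOpen_UHP (ι : Type*) [Finite ι] : IsOpen (UHP ι) := by
  rw [UHP_eq_pi]
  exact isOpen_set_pi Set.finite_univ fun _ _ => isOpen_lt continuous_const Complex.continuous_im

theorem convex_UHP (ι : Type*) : Convex ℝ (UHP ι) := by
  rw [UHP_eq_pi]
  exact convex_pi fun _ _ => convex_halfSpace_im_gt 0

theorem MvPolynomial.funext_UHP {ι : Type*} {p q : MvPolynomial ι ℂ}
    (h : ∀ z ∈ UHP ι, eval z p = eval z q) : p = q := by
  refine funext_set (fun _ => {c : ℂ | 0 < c.im}) (fun _ => ?_) fun z hz => h z ?_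
  · exact Set.infinite_of_injective_forall_mem (f := fun k : ℕ => (k : ℂ) + Complex.I)
      (fun a b hab => by simpa using hab) fun k => by simp
  · rwa [UHP_eq_pi]

theorem eqOn_zero_of_im_nonneg_of_eq_zero {U : Set ℂ} (hU : IsOpen U) (hconn : IsPreconnected U)
    {g : ℂ → ℂ} (hg : DifferentiableOn ℂ g U) (him : ∀ z ∈ U, 0 ≤ (g z).im)
    {z₀ : ℂ} (hz₀ : z₀ ∈ U) (h0 : g z₀ = 0) : Set.EqOn g 0 U := by
  rcases (hg.analyticOnNhd hU).is_constant_or_isOpen hconn with ⟨c, hc⟩ | hopen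
  · intro z hz
    rw [hc z hz, ← hc z₀ hz₀, h0, Pi.zero_apply]
  · obtain ⟨ε, hε, hball⟩ := Metric.isOpen_iff.mp (hopen U subset_rfl hU) (g z₀) ⟨z₀, hz₀, rfl⟩
    have hmem : -((ε / 2 : ℝ) : ℂ) * Complex.I ∈ Metric.ball (g z₀) ε := by
      rw [h0, mem_ball_zero_iff, norm_mul, norm_neg, Complex.norm_I, mul_one, Complex.norm_real,
        Real.norm_of_nonneg (by positivity)]
      linarith
    obtain ⟨z, hz, hgz⟩ := hball hmem
    have := him z hz
    rw [hgz] at this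
    simp only [neg_mul, Complex.neg_im, Complex.mul_I_im,
      Complex.ofReal_re] at this
    linarith

theorem eqOn_UHP_zero_of_im_nonneg_of_eq_zero {ι : Type*} [Fintype ι] {g : (ι → ℂ) → ℂ}
    (hg : DifferentiableOn ℂ g (UHP ι)) (him : ∀ z ∈ UHP ι, 0 ≤ (g z).im)
    {z₀ : ι → ℂ} (hz₀ : z₀ ∈ UHP ι) (h0 : g z₀ = 0) : Set.EqOn g 0 (UHP ι) := by
  intro z hz
  let L : ℂ → ι → ℂ := fun c => z₀ + c • (z - z₀)
  have hL : Differentiable ℂ L := by fun_prop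
  have h := eqOn_zero_of_im_nonneg_of_eq_zero (U := L ⁻¹' UHP ι) (g := g ∘ L) (z₀ := 0)
    ((isOpen_UHP ι).preimage hL.continuous)
    (((convex_UHP ι).translate_preimage_right z₀).linear_preimage
      ((LinearMap.toSpanSingleton ℂ _ (z - z₀)).restrictScalars ℝ)).isPreconnected
    (hg.comp hL.differentiableOn fun _ h => h) (fun c hc => him _ hc)
    (by simpa [L] using hz₀) (by simpa [L] using h0)
  simpa [L] using h (show (1 : ℂ) ∈ L ⁻¹' UHP ι by simpa [L] using hz)

theorem Matrix.eq_zero_of_forall_star_dotProduct_mulVec_eq_zero {m : ℕ}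
    {M : Matrix (Fin m) (Fin m) ℂ} (h : ∀ v, star v ⬝ᵥ M *ᵥ v = 0) : M = 0 := by
  refine Matrix.toEuclideanLin.map_eq_zero_iff.mp ((inner_map_self_eq_zero _).mp fun x => ?_)
  rw [← inner_conj_symm, EuclideanSpace.inner_eq_star_dotProduct, dotProduct_comm]
  exact (congrArg _ (h x.ofLp)).trans (map_zero _)

theorem eval_ne_zero_of_pick {ι : Type*} [Fintype ι] {m : ℕ}
    {P : Matrix (Fin m) (Fin m) (MvPolynomial ι ℂ)} {q : MvPolynomial ι ℂ} (hq : q ≠ 0)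
    (hcop : ∀ r, (∀ i j, r ∣ P i j) → r ∣ q → IsUnit r) {f : (ι → ℂ) → Matrix (Fin m) (Fin m) ℂ}
    (hf : ∀ z, f z = (eval z q)⁻¹ • Matrix.of fun i j => eval z (P i j))
    (hhol : ∀ i j, DifferentiableOn ℂ (fun z => f z i j) (UHP ι))
    (hpick : ∀ z ∈ UHP ι, (imPart (f z)).PosSemidef) {z : ι → ℂ} (hz : z ∈ UHP ι) :
    eval z q ≠ 0 := by
  intro hqz
  have hfz : f z = 0 := by rw [hf, hqz, _root_.inv_zero, zero_smul]
  have hf0 : ∀ w ∈ UHP ι, f w = 0 := fun w hw =>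
    Matrix.eq_zero_of_forall_star_dotProduct_mulVec_eq_zero fun v => by
      refine eqOn_UHP_zero_of_im_nonneg_of_eq_zero (g := fun w => star v ⬝ᵥ f w *ᵥ v) ?_
        (fun w hw => (posSemidef_imPart_iff _).mp (hpick w hw) v) hz (by simp [hfz]) hw
      simp only [dotProduct, mulVec]
      exact DifferentiableOn.fun_sum fun i _ => (DifferentiableOn.fun_sum fun j _ =>
        (hhol i j).mul_const _).const_mul _
  have hP : ∀ i j, P i j = 0 := fun i j => by
    refine (mul_eq_zero.mp (MvPolynomial.funext_UHP (q := 0) fun w hw => ?_)).resolve_left hq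
    have := congrFun (congrFun (hf0 w hw) i) j
    rw [hf] at this
    simpa using this
  exact ((hcop q (fun i j => by simp [hP]) dvd_rfl).map (eval z)).ne_zero hqz

/-- the degree reduction operator preserves the Pick class, producing a
function affine (degree at most one) and symmetric in the new variables `ζ₁,…,ζ_n`,
whose restriction to the diagonal `ζ₁ = ⋯ = ζ_n = z₀` is the original function. -/
theorem degree_reduction_preserves_Pick (d m n : ℕ)
    (P : Matrix (Fin m) (Fin m) (MvPolynomial (Fin (d + 1)) ℂ))
    (q : MvPolynomial (Fin (d + 1)) ℂ)
    (hcop : ∀ r : MvPolynomial (Fin (d + 1)) ℂ, (∀ i j, r ∣ P i j) → r ∣ q → IsUnit r)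
    (hdegP : ∀ i j, ((finSuccEquiv ℂ d (P i j)).natDegree) ≤ n)
    (hdegq : ((finSuccEquiv ℂ d q).natDegree) ≤ n)
    (f : (Fin (d + 1) → ℂ) → Matrix (Fin m) (Fin m) ℂ)
    (hfdef : ∀ z, f z = (eval z q)⁻¹ • Matrix.of fun i j => eval z (P i j))
    -- `f` belongs to the Pick class `𝒫_{d+1}^{m×m}` :
    (hfhol : ∀ i j, DifferentiableOn ℂ (fun z => f z i j) (UHP (Fin (d + 1))))
    (hfpick : ∀ z ∈ UHP (Fin (d + 1)), (imPart (f z)).PosSemidef)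
    (fhat : (Fin n ⊕ Fin d → ℂ) → Matrix (Fin m) (Fin m) ℂ)
    (hfhat : ∀ w, fhat w = (eval w (degRed d n q))⁻¹ •
      Matrix.of fun i j => eval w (degRed d n (P i j))) :
    -- `f̂` belongs to the Pick class `𝒫_{d+n}^{m×m}`
    (∀ i j, DifferentiableOn ℂ (fun w => fhat w i j) (UHP (Fin n ⊕ Fin d))) ∧
    (∀ w ∈ UHP (Fin n ⊕ Fin d), (imPart (fhat w)).PosSemidef) ∧
    -- `f̂` is affine (of degree at most one) in each `ζ_l`
    (∀ l : Fin n, degreeOf (Sum.inl l) (degRed d n q) ≤ 1 ∧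
      ∀ i j, degreeOf (Sum.inl l) (degRed d n (P i j)) ≤ 1) ∧
    -- `f̂` is symmetric in the variables `ζ₁,…,ζ_n`
    (∀ σ : Equiv.Perm (Fin n), rename (Sum.map σ id) (degRed d n q) = degRed d n q ∧
      ∀ i j, rename (Sum.map σ id) (degRed d n (P i j)) = degRed d n (P i j)) ∧
    -- on the diagonal `ζ₁ = ⋯ = ζ_n = z₀` one recovers `f`
    (∀ (a : ℂ) (z : Fin d → ℂ), fhat (Sum.elim (fun _ => a) z) = f (Fin.cons a z)) := by
  obtain rfl : f = _ := funext hfdef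
  obtain rfl : fhat = _ := funext hfhat
  refine ⟨?_, ?_, fun l => ⟨degreeOf_inl_degRed_le .., fun i j => degreeOf_inl_degRed_le ..⟩,
    fun σ => ⟨rename_sumMap_degRed .., fun i j => rename_sumMap_degRed ..⟩, fun a z => ?_⟩
  · intro i j
    rcases eq_or_ne q 0 with rfl | hq
    · simp [← degRedLinearMap_apply]
    · have hpoly : ∀ p : MvPolynomial (Fin n ⊕ Fin d) ℂ,
          DifferentiableOn ℂ (fun w => eval w p) (UHP (Fin n ⊕ Fin d)) := fun p =>
        (AnalyticOnNhd.eval_mvPolynomial p).differentiableOn.mono (Set.subset_univ _)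
      simp only [Matrix.smul_apply, of_apply, smul_eq_mul]
      exact ((hpoly _).inv fun w hw => eval_degRed_ne_zero hdegq
        (fun z hz => eval_ne_zero_of_pick hq hcop hfdef hfhol hfpick hz) hw).mul (hpoly _)
  · intro w hw
    rcases eq_or_ne q 0 with rfl | hq
    · simp [← degRedLinearMap_apply, imPart, PosSemidef.zero]
    · exact posSemidef_imPart_degRed hdegP hdegq
        (fun z hz => eval_ne_zero_of_pick hq hcop hfdef hfhol hfpick hz) hfpick hw
  · simp only [eval_degRed_diagonal hdegq, eval_degRed_diagonal (hdegP _ _)]
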